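/- Substitution lemma for parallel reduction: for φ-terms t, t', u, u' and any i ∈ ℕ, if t ⇛ t' and u ⇛ u' then t[ρ^i ↦ u] ⇛ t'[ρ^i ↦ u']. -/

import Mathlib

namespace PhiCalc

/-- φ-terms over a set of attribute labels `L`. An object term carries a finite
list of attributes: `(a, none)` is a void attribute, `(b, some t)` is an
attached attribute. -/
inductive Tm (L : Type) : Type where
  | loc : Nat → Tm L
  | dot : Tm L → L → Tm L
  | app : Tm L → L → Tm L → Tm L
  | obj : List (L × Option (Tm L)) → Tm L

namespace Tm

variable {L : Type}

/-- Look up a label among the attributes of an object: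
`none` = the label is missing, `some none` = void attribute,
`some (some t)` = attribute attached to `t`. -/
def lookupAttr [DecidableEq L] (a : L) : List (L × Option (Tm L)) → Option (Option (Tm L))
  | [] => none
  | (b, o) :: rest => if a = b then some o else lookupAttr a rest

/-- Attach term `u` to the (first occurrence of) label `a`. -/
def attachAttr [DecidableEq L] (a : L) (u : Tm L) :
    List (L × Option (Tm L)) → List (L × Option (Tm L))
  | [] => []
  | (b, o) :: rest => if a = b then (b, some u) :: rest else (b, o) :: attachAttr a u rest

mutual
/-- Locator increment `↑ₙ t`. -/
def incAt : Nat → Tm L → Tm L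
  | n, loc m => if m < n then loc m else loc (m + 1)
  | n, dot t a => dot (incAt n t) a
  | n, app t a u => app (incAt n t) a (incAt n u)
  | n, obj attrs => obj (incAtList (n + 1) attrs)

def incAtList : Nat → List (L × Option (Tm L)) → List (L × Option (Tm L))
  | _, [] => []
  | n, (a, none) :: rest => (a, none) :: incAtList n rest
  | n, (a, some t) :: rest => (a, some (incAt n t)) :: incAtList n rest
end

mutual
/-- Locator substitution `t[ρ^n ↦ u]`. -/
def subst : Tm L → Nat → Tm L → Tm L
  | loc m, n, u => if m < n then loc m else if m = n then u else loc (m - 1)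
  | dot t a, n, u => dot (subst t n u) a
  | app t a v, n, u => app (subst t n u) a (subst v n u)
  | obj attrs, n, u => obj (substList attrs (n + 1) (incAt 0 u))

def substList : List (L × Option (Tm L)) → Nat → Tm L → List (L × Option (Tm L))
  | [], _, _ => []
  | (a, none) :: rest, n, u => (a, none) :: substList rest n u
  | (a, some t) :: rest, n, u => (a, some (subst t n u)) :: substList rest n u
end

section Reductions

variable [DecidableEq L]

/-- One-step (regular) reduction `⇝`, parametrized by the decorator label `phi`. -/
inductive Step (phi : L) : Tm L → Tm L → Prop where
  | congObj {t t' : Tm L} (pre post : List (L × Option (Tm L))) (b : L) :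
      Step phi t t' →
      Step phi (obj (pre ++ (b, some t) :: post)) (obj (pre ++ (b, some t') :: post))
  | congDot {t t' : Tm L} (a : L) : Step phi t t' → Step phi (dot t a) (dot t' a)
  | congAppL {t t' u : Tm L} (a : L) : Step phi t t' → Step phi (app t a u) (app t' a u)
  | congAppR {t u u' : Tm L} (a : L) : Step phi u u' → Step phi (app t a u) (app t a u')
  | dotStep {attrs : List (L × Option (Tm L))} {c : L} {tc : Tm L} :
      lookupAttr c attrs = some (some tc) →
      Step phi (dot (obj attrs) c) (subst tc 0 (obj attrs))
  | dotPhi {attrs : List (L × Option (Tm L))} {c : L} :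
      lookupAttr c attrs = none → (lookupAttr phi attrs).isSome →
      Step phi (dot (obj attrs) c) (dot (dot (obj attrs) phi) c)
  | appStep {attrs : List (L × Option (Tm L))} {c : L} {u : Tm L} :
      lookupAttr c attrs = some none →
      Step phi (app (obj attrs) c u) (obj (attachAttr c (incAt 0 u) attrs))

mutual
/-- Parallel reduction `⇛`. -/
inductive Par (phi : L) : Tm L → Tm L → Prop where
  | loc (n : Nat) : Par phi (Tm.loc n) (Tm.loc n)
  | obj {attrs attrs' : List (L × Option (Tm L))} :
      ParAttrs phi attrs attrs' → Par phi (Tm.obj attrs) (Tm.obj attrs')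
  | congDot {t t' : Tm L} (a : L) : Par phi t t' → Par phi (Tm.dot t a) (Tm.dot t' a)
  | congApp {t t' u u' : Tm L} (a : L) :
      Par phi t t' → Par phi u u' → Par phi (Tm.app t a u) (Tm.app t' a u')
  | dotPar {t : Tm L} {attrs : List (L × Option (Tm L))} {c : L} {tc : Tm L} :
      Par phi t (Tm.obj attrs) → lookupAttr c attrs = some (some tc) →
      Par phi (Tm.dot t c) (subst tc 0 (Tm.obj attrs))
  | dotPhi {t : Tm L} {attrs : List (L × Option (Tm L))} {c : L} :
      Par phi t (Tm.obj attrs) → lookupAttr c attrs = none →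
      (lookupAttr phi attrs).isSome →
      Par phi (Tm.dot t c) (Tm.dot (Tm.dot (Tm.obj attrs) phi) c)
  | appPar {t : Tm L} {attrs : List (L × Option (Tm L))} {c : L} {u u' : Tm L} :
      Par phi t (Tm.obj attrs) → lookupAttr c attrs = some none → Par phi u u' →
      Par phi (Tm.app t c u) (Tm.obj (attachAttr c (incAt 0 u') attrs))

/-- Pointwise parallel reduction on attribute lists: void attributes are kept,
attached attributes reduce in parallel. -/
inductive ParAttrs (phi : L) :
    List (L × Option (Tm L)) → List (L × Option (Tm L)) → Prop where
  | nil : ParAttrs phi [] []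
  | void {rest rest' : List (L × Option (Tm L))} (a : L) :
      ParAttrs phi rest rest' → ParAttrs phi ((a, none) :: rest) ((a, none) :: rest')
  | attached {t t' : Tm L} {rest rest' : List (L × Option (Tm L))} (a : L) :
      Par phi t t' → ParAttrs phi rest rest' →
      ParAttrs phi ((a, some t) :: rest) ((a, some t') :: rest')
end

/-- Head reduction `→h`. -/
inductive Head (phi : L) : Tm L → Tm L → Prop where
  | dotStep {attrs : List (L × Option (Tm L))} {c : L} {tc : Tm L} :
      lookupAttr c attrs = some (some tc) →
      Head phi (dot (obj attrs) c) (subst tc 0 (obj attrs))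
  | dotPhi {attrs : List (L × Option (Tm L))} {c : L} :
      lookupAttr c attrs = none → (lookupAttr phi attrs).isSome →
      Head phi (dot (obj attrs) c) (dot (dot (obj attrs) phi) c)
  | appStep {attrs : List (L × Option (Tm L))} {c : L} {u : Tm L} :
      lookupAttr c attrs = some none →
      Head phi (app (obj attrs) c u) (obj (attachAttr c (incAt 0 u) attrs))
  | congDot {t t' : Tm L} (a : L) : Head phi t t' → Head phi (dot t a) (dot t' a)
  | congApp {t t' u : Tm L} (a : L) : Head phi t t' → Head phi (app t a u) (app t' a u)

/-- Internal parallel reduction `⇛ᵢ`. -/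
inductive ParI (phi : L) : Tm L → Tm L → Prop where
  | loc (n : Nat) : ParI phi (Tm.loc n) (Tm.loc n)
  | obj {attrs attrs' : List (L × Option (Tm L))} :
      ParAttrs phi attrs attrs' → ParI phi (Tm.obj attrs) (Tm.obj attrs')
  | congDot {t t' : Tm L} (a : L) : ParI phi t t' → ParI phi (Tm.dot t a) (Tm.dot t' a)
  | congApp {t t' u u' : Tm L} (a : L) :
      ParI phi t t' → Par phi u u' → ParI phi (Tm.app t a u) (Tm.app t' a u')

/-- Internal (regular) reduction `→ᵢ`. -/
inductive StepI (phi : L) : Tm L → Tm L → Prop where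
  | congObj {t t' : Tm L} (pre post : List (L × Option (Tm L))) (b : L) :
      Step phi t t' →
      StepI phi (obj (pre ++ (b, some t) :: post)) (obj (pre ++ (b, some t') :: post))
  | congDot {t t' : Tm L} (a : L) : StepI phi t t' → StepI phi (dot t a) (dot t' a)
  | congAppL {t t' u : Tm L} (a : L) : StepI phi t t' → StepI phi (app t a u) (app t' a u)
  | congAppR {t u u' : Tm L} (a : L) : Step phi u u' → StepI phi (app t a u) (app t a u')

end Reductions

end Tm

end PhiCalc
namespace PhiCalc
namespace Tm
section Extra
variable {L : Type} [DecidableEq L]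

mutual
/-- Complete development `t⁺`. -/
def cd (phi : L) : Tm L → Tm L
  | loc n => loc n
  | dot t a =>
    match cd phi t with
    | obj attrs =>
      match lookupAttr a attrs with
      | some (some ta) => subst ta 0 (obj attrs)
      | some none => dot (obj attrs) a
      | none =>
        if (lookupAttr phi attrs).isSome then dot (dot (obj attrs) phi) a
        else dot (obj attrs) a
    | t' => dot t' a
  | app t a u =>
    match cd phi t with
    | obj attrs =>
      match lookupAttr a attrs with
      | some none => obj (attachAttr a (incAt 0 (cd phi u)) attrs)
      | _ => app (obj attrs) a (cd phi u)
    | t' => app t' a (cd phi u)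
  | obj attrs => obj (cdList phi attrs)

def cdList (phi : L) : List (L × Option (Tm L)) → List (L × Option (Tm L))
  | [] => []
  | (a, none) :: rest => (a, none) :: cdList phi rest
  | (a, some t) :: rest => (a, some (cd phi t)) :: cdList phi rest
end

/-- Head reduction as a (deterministic) partial function. -/
def headRed (phi : L) : Tm L → Option (Tm L)
  | loc _ => none
  | obj _ => none
  | dot t a =>
    match t with
    | obj attrs =>
      match lookupAttr a attrs with
      | some (some ta) => some (subst ta 0 (obj attrs))
      | some none => none
      | none =>
        if (lookupAttr phi attrs).isSome then some (dot (dot (obj attrs) phi) a)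
        else none
    | t => (headRed phi t).map (fun t' => dot t' a)
  | app t a u =>
    match t with
    | obj attrs =>
      match lookupAttr a attrs with
      | some none => some (obj (attachAttr a (incAt 0 u) attrs))
      | _ => none
    | t => (headRed phi t).map (fun t' => app t' a u)

mutual
/-- Normal order reduction `⇝ℓ` as a (deterministic) partial function:
head reduction first, otherwise reduce the leftmost subterm that reduces. -/
def nordRed (phi : L) : Tm L → Option (Tm L)
  | loc _ => none
  | dot t a =>
    match headRed phi (dot t a) with
    | some s => some s
    | none => (nordRed phi t).map (fun t' => dot t' a)
  | app t a u =>
    match headRed phi (app t a u) with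
    | some s => some s
    | none =>
      match nordRed phi t with
      | some t' => some (app t' a u)
      | none => (nordRed phi u).map (fun u' => app t a u')
  | obj attrs => (nordList phi attrs).map obj

def nordList (phi : L) : List (L × Option (Tm L)) → Option (List (L × Option (Tm L)))
  | [] => none
  | (a, none) :: rest => (nordList phi rest).map (fun rest' => (a, none) :: rest')
  | (a, some t) :: rest =>
    match nordRed phi t with
    | some t' => some ((a, some t') :: rest)
    | none => (nordList phi rest).map (fun rest' => (a, some t) :: rest')
end

/-- Normal order reduction relation. -/
def NOrd (phi : L) (t t' : Tm L) : Prop := nordRed phi t = some t'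

end Extra
end Tm
end PhiCalc
namespace PhiCalc
namespace Tm
section Substitution
variable {L : Type}

mutual
theorem incAt_incAt : ∀ (t : Tm L) {m n : ℕ}, m ≤ n →
    incAt m (incAt n t) = incAt (n + 1) (incAt m t)
  | loc k, m, n, h => by
    simp only [incAt]
    split_ifs <;> simp only [incAt] <;> split_ifs <;> first | rfl | omega
  | dot t a, m, n, h => by simp only [incAt, incAt_incAt t h]
  | app t a v, m, n, h => by simp only [incAt, incAt_incAt t h, incAt_incAt v h]
  | obj attrs, m, n, h => by
    simp only [incAt, incAtList_incAtList attrs (Nat.succ_le_succ h)]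

theorem incAtList_incAtList : ∀ (l : List (L × Option (Tm L))) {m n : ℕ}, m ≤ n →
    incAtList m (incAtList n l) = incAtList (n + 1) (incAtList m l)
  | [], m, n, h => by simp only [incAtList]
  | (a, none) :: rest, m, n, h => by simp only [incAtList, incAtList_incAtList rest h]
  | (a, some t) :: rest, m, n, h => by
    simp only [incAtList, incAt_incAt t h, incAtList_incAtList rest h]
end

mutual
theorem incAt_subst_of_le : ∀ (t : Tm L) {k n : ℕ} (u : Tm L), k ≤ n →
    incAt k (subst t n u) = subst (incAt k t) (n + 1) (incAt k u)
  | loc m, k, n, u, h => by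
    simp only [incAt, subst]
    split_ifs <;> simp only [incAt, subst] <;> split_ifs <;>
      first | rfl | omega | (congr 1; omega)
  | dot t a, k, n, u, h => by simp only [incAt, subst, incAt_subst_of_le t u h]
  | app t a v, k, n, u, h => by
    simp only [incAt, subst, incAt_subst_of_le t u h, incAt_subst_of_le v u h]
  | obj attrs, k, n, u, h => by
    simp only [incAt, subst, incAtList_substList_of_le attrs (incAt 0 u) (Nat.succ_le_succ h),
      incAt_incAt u (Nat.zero_le k)]

theorem incAtList_substList_of_le : ∀ (l : List (L × Option (Tm L))) {k n : ℕ} (u : Tm L),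
    k ≤ n → incAtList k (substList l n u) = substList (incAtList k l) (n + 1) (incAt k u)
  | [], k, n, u, h => by simp only [incAtList, substList]
  | (a, none) :: rest, k, n, u, h => by
    simp only [incAtList, substList, incAtList_substList_of_le rest u h]
  | (a, some t) :: rest, k, n, u, h => by
    simp only [incAtList, substList, incAt_subst_of_le t u h, incAtList_substList_of_le rest u h]
end

mutual
theorem incAt_subst_of_ge : ∀ (t : Tm L) {k n : ℕ} (u : Tm L), n ≤ k →
    incAt k (subst t n u) = subst (incAt (k + 1) t) n (incAt k u)
  | loc m, k, n, u, h => by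
    simp only [incAt, subst]
    split_ifs <;> simp only [incAt, subst] <;> split_ifs <;>
      first | rfl | omega | (congr 1; omega)
  | dot t a, k, n, u, h => by simp only [incAt, subst, incAt_subst_of_ge t u h]
  | app t a v, k, n, u, h => by
    simp only [incAt, subst, incAt_subst_of_ge t u h, incAt_subst_of_ge v u h]
  | obj attrs, k, n, u, h => by
    simp only [incAt, subst, incAtList_substList_of_ge attrs (incAt 0 u) (Nat.succ_le_succ h),
      incAt_incAt u (Nat.zero_le k)]

theorem incAtList_substList_of_ge : ∀ (l : List (L × Option (Tm L))) {k n : ℕ} (u : Tm L),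
    n ≤ k → incAtList k (substList l n u) = substList (incAtList (k + 1) l) n (incAt k u)
  | [], k, n, u, h => by simp only [incAtList, substList]
  | (a, none) :: rest, k, n, u, h => by
    simp only [incAtList, substList, incAtList_substList_of_ge rest u h]
  | (a, some t) :: rest, k, n, u, h => by
    simp only [incAtList, substList, incAt_subst_of_ge t u h, incAtList_substList_of_ge rest u h]
end

mutual
theorem subst_incAt : ∀ (t : Tm L) (n : ℕ) (u : Tm L), subst (incAt n t) n u = t
  | loc m, n, u => by
    simp only [incAt]
    split_ifs <;> simp only [subst] <;> split_ifs <;> first | rfl | omega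
  | dot t a, n, u => by simp only [incAt, subst, subst_incAt t]
  | app t a v, n, u => by simp only [incAt, subst, subst_incAt t, subst_incAt v]
  | obj attrs, n, u => by simp only [incAt, subst, substList_incAtList attrs]

theorem substList_incAtList : ∀ (l : List (L × Option (Tm L))) (n : ℕ) (u : Tm L),
    substList (incAtList n l) n u = l
  | [], n, u => by simp only [incAtList, substList]
  | (a, none) :: rest, n, u => by simp only [incAtList, substList, substList_incAtList rest]
  | (a, some t) :: rest, n, u => by
    simp only [incAtList, substList, subst_incAt t, substList_incAtList rest]
end

mutual
theorem subst_subst : ∀ (t : Tm L) {m n : ℕ} (v u : Tm L), m ≤ n →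
    subst (subst t m v) n u = subst (subst t (n + 1) (incAt m u)) m (subst v n u)
  | loc k, m, n, v, u, h => by
    rcases lt_trichotomy k m with hk | rfl | hk
    · simp [subst, hk, show k < n by omega, show k < n + 1 by omega]
    · simp [subst, show k < n + 1 by omega]
    · rcases lt_trichotomy k (n + 1) with hn | rfl | hn
      · simp [subst, hn, show ¬ k < m by omega, show k ≠ m by omega, show k - 1 < n by omega]
      · simp [subst, show ¬ n + 1 < m by omega, show n + 1 ≠ m by omega, subst_incAt]
      · simp [subst, show ¬ k < m by omega, show k ≠ m by omega, show ¬ k < n + 1 by omega,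
          show k ≠ n + 1 by omega, show ¬ k - 1 < n by omega, show k - 1 ≠ n by omega,
          show ¬ k - 1 < m by omega, show k - 1 ≠ m by omega]
  | dot t a, m, n, v, u, h => by simp only [subst, subst_subst t v u h]
  | app t a w, m, n, v, u, h => by
    simp only [subst, subst_subst t v u h, subst_subst w v u h]
  | obj attrs, m, n, v, u, h => by
    simp only [subst, substList_substList attrs (incAt 0 v) (incAt 0 u) (Nat.succ_le_succ h),
      incAt_incAt u (Nat.zero_le m), incAt_subst_of_le v u (Nat.zero_le n)]

theorem substList_substList : ∀ (l : List (L × Option (Tm L))) {m n : ℕ} (v u : Tm L), m ≤ n →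
    substList (substList l m v) n u =
      substList (substList l (n + 1) (incAt m u)) m (subst v n u)
  | [], m, n, v, u, h => by simp only [substList]
  | (a, none) :: rest, m, n, v, u, h => by
    simp only [substList, substList_substList rest v u h]
  | (a, some t) :: rest, m, n, v, u, h => by
    simp only [substList, subst_subst t v u h, substList_substList rest v u h]
end

variable [DecidableEq L]

theorem lookupAttr_incAtList (c : L) (n : ℕ) : ∀ l : List (L × Option (Tm L)),
    lookupAttr c (incAtList n l) = (lookupAttr c l).map (Option.map (incAt n))
  | [] => by simp [incAtList, lookupAttr]
  | (a, none) :: rest => by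
    simp only [incAtList, lookupAttr, lookupAttr_incAtList c n rest]; split_ifs <;> rfl
  | (a, some t) :: rest => by
    simp only [incAtList, lookupAttr, lookupAttr_incAtList c n rest]; split_ifs <;> rfl

theorem lookupAttr_substList (c : L) (n : ℕ) (u : Tm L) : ∀ l : List (L × Option (Tm L)),
    lookupAttr c (substList l n u) = (lookupAttr c l).map (Option.map (subst · n u))
  | [] => by simp [substList, lookupAttr]
  | (a, none) :: rest => by
    simp only [substList, lookupAttr, lookupAttr_substList c n u rest]; split_ifs <;> rfl
  | (a, some t) :: rest => by
    simp only [substList, lookupAttr, lookupAttr_substList c n u rest]; split_ifs <;> rfl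

theorem incAtList_attachAttr (c : L) (n : ℕ) (v : Tm L) : ∀ l : List (L × Option (Tm L)),
    incAtList n (attachAttr c v l) = attachAttr c (incAt n v) (incAtList n l)
  | [] => by simp [incAtList, attachAttr]
  | (a, none) :: rest => by
    simp only [incAtList, attachAttr]
    split_ifs <;> simp [incAtList, incAtList_attachAttr c n v rest]
  | (a, some t) :: rest => by
    simp only [incAtList, attachAttr]
    split_ifs <;> simp [incAtList, incAtList_attachAttr c n v rest]

theorem substList_attachAttr (c : L) (n : ℕ) (u v : Tm L) : ∀ l : List (L × Option (Tm L)),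
    substList (attachAttr c v l) n u = attachAttr c (subst v n u) (substList l n u)
  | [] => by simp [substList, attachAttr]
  | (a, none) :: rest => by
    simp only [substList, attachAttr]
    split_ifs <;> simp [substList, substList_attachAttr c n u v rest]
  | (a, some t) :: rest => by
    simp only [substList, attachAttr]
    split_ifs <;> simp [substList, substList_attachAttr c n u v rest]

mutual
theorem Par.incAt {phi : L} : ∀ {t t' : Tm L} (n : ℕ), Par phi t t' →
    Par phi (incAt n t) (incAt n t')
  | _, _, n, .loc m => by
    simp only [Tm.incAt]; split_ifs <;> exact .loc _
  | _, _, n, .obj h => by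
    simp only [Tm.incAt]; exact .obj (ParAttrs.incAtList (n + 1) h)
  | _, _, n, .congDot a h => by
    simp only [Tm.incAt]; exact .congDot a (Par.incAt n h)
  | _, _, n, .congApp a h h' => by
    simp only [Tm.incAt]; exact .congApp a (Par.incAt n h) (Par.incAt n h')
  | _, _, n, .dotPar (attrs := attrs) (c := c) h hl => by
    have ih := Par.incAt n h
    simp only [Tm.incAt, incAt_subst_of_ge _ _ (Nat.zero_le n)] at ih ⊢
    exact .dotPar ih (by simp [lookupAttr_incAtList, hl])
  | _, _, n, .dotPhi h hl hphi => by
    have ih := Par.incAt n h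
    simp only [Tm.incAt] at ih ⊢
    exact .dotPhi ih (by simp [lookupAttr_incAtList, hl])
      (by simpa [lookupAttr_incAtList] using hphi)
  | _, _, n, .appPar h hl hu => by
    have ih := Par.incAt n h
    simp only [Tm.incAt, incAtList_attachAttr, ← incAt_incAt _ (Nat.zero_le n)] at ih ⊢
    exact .appPar ih (by simp [lookupAttr_incAtList, hl]) (Par.incAt n hu)

theorem ParAttrs.incAtList {phi : L} : ∀ {l l' : List (L × Option (Tm L))} (n : ℕ),
    ParAttrs phi l l' → ParAttrs phi (incAtList n l) (incAtList n l')
  | _, _, n, .nil => by simp only [Tm.incAtList]; exact .nil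
  | _, _, n, .void a h => by
    simp only [Tm.incAtList]; exact .void a (ParAttrs.incAtList n h)
  | _, _, n, .attached a h h' => by
    simp only [Tm.incAtList]; exact .attached a (Par.incAt n h) (ParAttrs.incAtList n h')
end

mutual
theorem Par.subst {phi : L} : ∀ {t t' u u' : Tm L} (i : ℕ), Par phi t t' → Par phi u u' →
    Par phi (subst t i u) (subst t' i u')
  | _, _, _, _, i, .loc m, hu => by
    simp only [Tm.subst]; split_ifs <;> first | exact hu | exact .loc _
  | _, _, _, _, i, .obj h, hu => by
    simp only [Tm.subst]; exact .obj (ParAttrs.substList (i + 1) h (hu.incAt 0))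
  | _, _, _, _, i, .congDot a h, hu => by
    simp only [Tm.subst]; exact .congDot a (Par.subst i h hu)
  | _, _, _, _, i, .congApp a h h', hu => by
    simp only [Tm.subst]; exact .congApp a (Par.subst i h hu) (Par.subst i h' hu)
  | _, _, _, _, i, .dotPar h hl, hu => by
    have ih := Par.subst i h hu
    simp only [subst_subst _ _ _ (Nat.zero_le i)]
    simp only [Tm.subst] at ih ⊢
    exact .dotPar ih (by simp [lookupAttr_substList, hl])
  | _, _, _, _, i, .dotPhi h hl hphi, hu => by
    have ih := Par.subst i h hu
    simp only [Tm.subst] at ih ⊢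
    exact .dotPhi ih (by simp [lookupAttr_substList, hl])
      (by simpa [lookupAttr_substList] using hphi)
  | _, _, _, _, i, .appPar h hl hv, hu => by
    have ih := Par.subst i h hu
    simp only [Tm.subst, substList_attachAttr, ← incAt_subst_of_le _ _ (Nat.zero_le i)] at ih ⊢
    exact .appPar ih (by simp [lookupAttr_substList, hl]) (Par.subst i hv hu)

theorem ParAttrs.substList {phi : L} : ∀ {l l' : List (L × Option (Tm L))} {u u' : Tm L}
    (i : ℕ), ParAttrs phi l l' → Par phi u u' →
    ParAttrs phi (substList l i u) (substList l' i u')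
  | _, _, _, _, i, .nil, hu => by simp only [Tm.substList]; exact .nil
  | _, _, _, _, i, .void a h, hu => by
    simp only [Tm.substList]; exact .void a (ParAttrs.substList i h hu)
  | _, _, _, _, i, .attached a h h', hu => by
    simp only [Tm.substList]
    exact .attached a (Par.subst i h hu) (ParAttrs.substList i h' hu)
end

end Substitution
end Tm
end PhiCalc

open PhiCalc Tm in
/-- Substitution lemma for parallel reduction: if `t ⇛ t'` and `u ⇛ u'` then
`t[ρ^i ↦ u] ⇛ t'[ρ^i ↦ u']`. -/
theorem par_subst {L : Type} [DecidableEq L] (phi : L) {t t' u u' : Tm L} (i : ℕ)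
    (ht : Par phi t t') (hu : Par phi u u') :
    Par phi (subst t i u) (subst t' i u') := Par.subst i ht hu
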